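/- For nonzero vectors x, y in R^n, (1/2)·Σ_{i=1}^n |x_i²/‖x‖² − y_i²/‖y‖²| ≤ ‖x/‖x‖ − y/‖y‖‖. -/

import Mathlib

theorem EuclideanSpace.sum_abs_sq_sub_sq_le {ι : Type*} [Fintype ι] (u v : EuclideanSpace ℝ ι) :
    ∑ i, |u i ^ 2 - v i ^ 2| ≤ ‖u + v‖ * ‖u - v‖ := by
  have h := Real.sum_mul_le_sqrt_mul_sqrt Finset.univ (fun i => |(u + v) i|) (fun i => |(u - v) i|)
  rw [EuclideanSpace.norm_eq, EuclideanSpace.norm_eq]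
  simpa only [Real.norm_eq_abs, PiLp.add_apply, PiLp.sub_apply, ← abs_mul, sq_sub_sq] using h

theorem stmt_1 {n : ℕ} (x y : EuclideanSpace ℝ (Fin n)) (hx : x ≠ 0) (hy : y ≠ 0) :
    (1 / 2) * ∑ i, |x i ^ 2 / ‖x‖ ^ 2 - y i ^ 2 / ‖y‖ ^ 2| ≤ ‖‖x‖⁻¹ • x - ‖y‖⁻¹ • y‖ := by
  have h := EuclideanSpace.sum_abs_sq_sub_sq_le (‖x‖⁻¹ • x) (‖y‖⁻¹ • y)
  have hadd : ‖‖x‖⁻¹ • x + ‖y‖⁻¹ • y‖ ≤ 2 := by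
    refine (norm_add_le _ _).trans_eq ?_
    rw [norm_smul, norm_smul, norm_inv, norm_inv, norm_norm, norm_norm,
      inv_mul_cancel₀ (norm_ne_zero_iff.2 hx), inv_mul_cancel₀ (norm_ne_zero_iff.2 hy)]
    norm_num
  have hsum : ∑ i, |x i ^ 2 / ‖x‖ ^ 2 - y i ^ 2 / ‖y‖ ^ 2| =
      ∑ i, |(‖x‖⁻¹ • x) i ^ 2 - (‖y‖⁻¹ • y) i ^ 2| := by
    simp only [PiLp.smul_apply, smul_eq_mul, inv_mul_eq_div, div_pow]
  have hmul := mul_le_mul_of_nonneg_right hadd (norm_nonneg (‖x‖⁻¹ • x - ‖y‖⁻¹ • y))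
  rw [hsum]
  linarith
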